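/- Let G be a finite group and H a subgroup of G such that the interval [H,G] is top Boolean, i.e. the interval [t, G] is a Boolean lattice, where t is the intersection of all maximal subgroups of G containing H. Then there exists g ∈ G such that ⟨H, g⟩ = G. -/

import Mathlib

/-- If the subgroups containing `t` satisfy the distributive law and `⟨t, a⟩ ⊓ ⟨t, b⟩ = t`, then
`⟨t, a * b⟩` contains `⟨t, a⟩ ⊔ ⟨t, b⟩`. -/
theorem Subgroup.sup_sup_le_sup_closure_mul {G : Type*} [Group G] {t : Subgroup G}
    (hdistrib : ∀ K₁ K₂ K₃ : Subgroup G, t ≤ K₁ → t ≤ K₂ → t ≤ K₃ →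
      K₁ ⊓ (K₂ ⊔ K₃) = (K₁ ⊓ K₂) ⊔ (K₁ ⊓ K₃))
    {a b : G} (hab : (t ⊔ closure {a}) ⊓ (t ⊔ closure {b}) = t) :
    (t ⊔ closure {a}) ⊔ (t ⊔ closure {b}) ≤ t ⊔ closure {a * b} := by
  have hmem (g : G) : g ∈ t ⊔ closure {g} :=
    mem_sup_right (subset_closure (Set.mem_singleton g))
  have hle {K : Subgroup G} {g : G} (hK : t ≤ K) (hg : g ∈ K) : t ⊔ closure {g} ≤ K :=
    sup_le hK (by simpa using hg)
  have ha := hmem a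
  have hb := hmem b
  have hr := hmem (a * b)
  have htP : t ≤ t ⊔ closure {a} := le_sup_left
  have htQ : t ≤ t ⊔ closure {b} := le_sup_left
  have htR : t ≤ t ⊔ closure {a * b} := le_sup_left
  have hQ : t ⊔ closure {b} ≤ (t ⊔ closure {a * b}) ⊔ (t ⊔ closure {a}) := by
    refine hle (htR.trans le_sup_left) ?_
    simpa using mul_mem (inv_mem (mem_sup_right ha)) (mem_sup_left hr)
  have hP : t ⊔ closure {a} ≤ (t ⊔ closure {a * b}) ⊔ (t ⊔ closure {b}) := by
    refine hle (htR.trans le_sup_left) ?_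
    simpa using mul_mem (mem_sup_left hr) (inv_mem (mem_sup_right hb))
  generalize t ⊔ closure {a} = P at *
  generalize t ⊔ closure {b} = Q at *
  generalize t ⊔ closure {a * b} = R at *
  have hQR : Q ≤ R := by
    have h := hdistrib Q R P htQ htR htP
    rw [inf_eq_left.2 hQ, inf_comm Q P, hab] at h
    rw [h]
    exact sup_le inf_le_right htR
  exact sup_le (hP.trans (sup_le le_rfl hQR)) hQR

/-- If the subgroups containing `t` satisfy the distributive law and are complemented, then each
of them is generated by `t` and one further element. -/
theorem Subgroup.exists_sup_closure_singleton_eq {G : Type*} [Group G] [Finite G] {t : Subgroup G}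
    (hdistrib : ∀ K₁ K₂ K₃ : Subgroup G, t ≤ K₁ → t ≤ K₂ → t ≤ K₃ →
      K₁ ⊓ (K₂ ⊔ K₃) = (K₁ ⊓ K₂) ⊔ (K₁ ⊓ K₃))
    (hcompl : ∀ K : Subgroup G, t ≤ K →
      ∃ K' : Subgroup G, t ≤ K' ∧ K ⊓ K' = t ∧ K ⊔ K' = ⊤)
    (K : Subgroup G) (hK : t ≤ K) : ∃ g : G, t ⊔ closure {g} = K := by
  induction K using WellFoundedLT.induction with
  | ind K ih =>
    rcases hK.eq_or_lt with rfl | hlt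
    · exact ⟨1, by simp⟩
    obtain ⟨x, hxK, hxt⟩ := SetLike.exists_of_lt hlt
    have hxL : x ∈ t ⊔ closure {x} := mem_sup_right (subset_closure (Set.mem_singleton x))
    have hLK : t ⊔ closure {x} ≤ K := sup_le hK (by simpa using hxK)
    rcases hLK.eq_or_lt with hL | hL
    · exact ⟨x, hL⟩
    obtain ⟨L', htL', hinf, hsup⟩ := hcompl (t ⊔ closure {x}) le_sup_left
    have hne : K ⊓ L' < K := by
      refine inf_le_left.lt_of_ne fun h => hxt ?_
      rw [← hinf]
      exact ⟨hxL, inf_eq_left.1 h hxK⟩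
    obtain ⟨y, hy⟩ := ih _ hne (le_inf hK htL')
    have hxy : (t ⊔ closure {x}) ⊓ (t ⊔ closure {y}) = t := by
      rw [hy, ← inf_assoc, inf_eq_left.2 hLK, hinf]
    have hyK : y ∈ K :=
      (hy.le.trans inf_le_left) (mem_sup_right (subset_closure (Set.mem_singleton y)))
    refine ⟨x * y, le_antisymm (sup_le hK (by simpa using mul_mem hxK hyK)) ?_⟩
    refine le_trans ?_ (sup_sup_le_sup_closure_mul hdistrib hxy)
    have h := hdistrib K (t ⊔ closure {x}) L' hK le_sup_left htL'
    rw [hsup, inf_top_eq, inf_eq_right.2 hLK] at h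
    rw [hy]
    exact h.le


/-- If the interval `[H,G]` is top Boolean, i.e. the interval `[t,G]` is a Boolean lattice
where `t` is the intersection of all maximal subgroups of `G` containing `H`
(it is bounded, and we assume it is distributive and complemented),
then there exists `g : G` with `⟨H, g⟩ = G`. -/
theorem stmt5 {G : Type*} [Group G] [Finite G] (H t : Subgroup G)
    (ht : t = sInf {M : Subgroup G | H ≤ M ∧ IsCoatom M})
    (hdistrib : ∀ K₁ K₂ K₃ : Subgroup G, t ≤ K₁ → t ≤ K₂ → t ≤ K₃ →
      K₁ ⊓ (K₂ ⊔ K₃) = (K₁ ⊓ K₂) ⊔ (K₁ ⊓ K₃))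
    (hcompl : ∀ K : Subgroup G, t ≤ K →
      ∃ K' : Subgroup G, t ≤ K' ∧ K ⊓ K' = t ∧ K ⊔ K' = ⊤) :
    ∃ g : G, H ⊔ Subgroup.closure {g} = ⊤ := by
  obtain ⟨g, hg⟩ := Subgroup.exists_sup_closure_singleton_eq hdistrib hcompl ⊤ le_top
  refine ⟨g, (eq_top_or_exists_le_coatom _).resolve_right ?_⟩
  rintro ⟨M, hM, hle⟩
  have htM : t ≤ M := ht.trans_le (sInf_le ⟨le_sup_left.trans hle, hM⟩)
  exact hM.1 (top_le_iff.1 (hg.ge.trans (sup_le htM (le_sup_right.trans hle))))
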